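/- Let f_1, f_2 ∈ B_6 and let f = f_1||f_2 ∈ B_7. Then for every g ∈ B_6 with deg(g) ≤ 2 (i.e., g ∈ RM(2,6)), the second-order nonlinearity of the concatenation satisfies nl_2(f) ≤ nl(f_1 + g) + nl(f_2 + g). -/

import Mathlib

open scoped BigOperators

/-- Boolean functions in `n` variables. -/
abbrev BF (n : ℕ) := (Fin n → ZMod 2) → ZMod 2

/-- Hamming distance between two Boolean functions. -/
def hd {n : ℕ} (f g : BF n) : ℕ :=
  (Finset.univ.filter (fun x : Fin n → ZMod 2 => f x ≠ g x)).card

/-- The Reed--Muller code `RM(r,n)`: Boolean functions given by evaluation of a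
multivariate polynomial over `F_2` of total degree at most `r`. -/
def RM (r n : ℕ) : Set (BF n) :=
  {f | ∃ p : MvPolynomial (Fin n) (ZMod 2),
    p.totalDegree ≤ r ∧ ∀ x, f x = MvPolynomial.eval x p}

/-- The `r`-th order nonlinearity of a Boolean function. -/
noncomputable def nl (r : ℕ) {n : ℕ} (f : BF n) : ℕ :=
  sInf {d | ∃ g ∈ RM r n, d = hd f g}

/-- Concatenation `f1 || f2` of two Boolean functions. -/
def concat {n : ℕ} (f1 f2 : BF n) : BF (n + 1) :=
  fun x => (1 + x (Fin.last n)) * f1 (x ∘ Fin.castSucc)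
    + x (Fin.last n) * f2 (x ∘ Fin.castSucc)

/-- A Boolean function is homogeneous quadratic if it is of the form
`∑_{i<j} a_{ij} x_i x_j`. -/
def HomQuad {n : ℕ} (g : BF n) : Prop :=
  ∃ a : Fin n → Fin n → ZMod 2,
    ∀ x, g x = ∑ i : Fin n, ∑ j : Fin n, (if i < j then a i j * x i * x j else 0)

/-- `Fh f r` is the set of homogeneous quadratic functions `g` with `nl(f+g) = r`. -/
def Fh {n : ℕ} (f : BF n) (r : ℕ) : Set (BF n) :=
  {g | HomQuad g ∧ nl 1 (f + g) = r}

/-- `NFh f r = |Fh f r|`. -/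
noncomputable def NFh {n : ℕ} (f : BF n) (r : ℕ) : ℕ := (Fh f r).ncard

/-- The set of 6-variable Boolean functions with nonlinearity 16. -/
def S16 : Set (BF 6) := {f | nl 1 f = 16}

/-- `f1` and `f2` are affine equivalent modulo `RM(r,n)`. -/
def AffEquivMod (r n : ℕ) (f1 f2 : BF n) : Prop :=
  ∃ A : Matrix (Fin n) (Fin n) (ZMod 2), IsUnit A ∧ ∃ b : Fin n → ZMod 2,
    (fun x => f1 x + f2 (A.mulVec x + b)) ∈ RM r n

def fun1 : BF 6 := fun x => x 0*x 1*x 5 + x 0*x 2*x 4 + x 1*x 2*x 3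

def fun2 : BF 6 := fun x => x 0*x 1*x 2*x 3 + x 0*x 1*x 5 + x 0*x 3*x 4 + x 1*x 2*x 4

def fun3 : BF 6 := fun x => x 0*x 1*x 2*x 3 + x 0*x 2*x 4 + x 0*x 3*x 5 + x 1*x 2*x 4
  + x 1*x 2*x 5 + x 1*x 3*x 4

def fun4 : BF 6 := fun x => x 0*x 1*x 2*x 5 + x 0*x 1*x 3*x 4 + x 0*x 2*x 4
  + x 0*x 3*x 4 + x 0*x 3*x 5 + x 1*x 2*x 3

def fun5 : BF 6 := fun x => x 0*x 1*x 2*x 3*x 4 + x 0*x 2*x 4 + x 0*x 3*x 5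
  + x 1*x 2*x 4 + x 1*x 2*x 5 + x 1*x 3*x 4

def fun6 : BF 6 := fun x => x 0*x 1*x 2*x 3*x 4*x 5 + x 0*x 1*x 5 + x 0*x 2*x 4
  + x 1*x 2*x 3

def fun7 : BF 6 := fun x => x 0*x 1*x 2*x 3*x 4*x 5 + x 0*x 1*x 2*x 3 + x 0*x 1*x 5
  + x 0*x 3*x 4 + x 1*x 2*x 4 + x 3*x 4

def fun8 : BF 6 := fun x => x 0*x 1*x 2*x 3*x 4*x 5 + x 0*x 1*x 2*x 3 + x 0*x 2*x 4
  + x 0*x 3*x 5 + x 1*x 2*x 4 + x 1*x 2*x 5 + x 1*x 3*x 4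

def fun9 : BF 6 := fun x => x 0*x 1*x 2*x 3*x 4*x 5 + x 0*x 1*x 2*x 5 + x 0*x 1*x 3*x 4
  + x 0*x 2*x 4 + x 0*x 3*x 4 + x 0*x 3*x 5 + x 1*x 2*x 3 + x 3*x 5

def fun10 : BF 6 := fun x => x 0*x 1*x 2*x 3*x 4*x 5 + x 0*x 1*x 2*x 3 + x 0*x 2*x 3
  + x 0*x 4*x 5 + x 1*x 2*x 3 + x 1*x 2*x 5 + x 1*x 3*x 4 + x 2*x 3 + x 2*x 5 + x 3*x 4

def fun11 : BF 6 := fun x => x 0*x 1*x 2*x 3*x 4*x 5 + x 0*x 1*x 2*x 5 + x 0*x 1*x 3*x 4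
  + x 0*x 2*x 4 + x 0*x 3*x 4 + x 0*x 3*x 5 + x 1*x 2*x 3 + x 1*x 2*x 5 + x 1*x 3*x 4
  + x 2*x 4 + x 3*x 4 + x 3*x 5

def fun12 : BF 6 := fun x => x 0*x 1*x 2*x 3*x 4*x 5 + x 1*x 2*x 3*x 4 + x 0*x 1*x 4*x 5
  + x 0*x 2*x 3*x 5 + x 0*x 1*x 3 + x 0*x 1*x 4 + x 1*x 2*x 4 + x 2*x 3*x 4
  + x 0*x 1*x 5 + x 2*x 3*x 5

def g0 : BF 6 := fun x => x 0*x 1*x 2 + x 0*x 3*x 4 + x 1*x 3*x 5 + x 2*x 4*x 5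
  + x 3*x 4*x 5


theorem exists_hd_eq_nl (r : ℕ) {n : ℕ} (f : BF n) : ∃ g ∈ RM r n, nl r f = hd f g :=
  Nat.sInf_mem (s := {d | ∃ g ∈ RM r n, d = hd f g}) ⟨_, 0, ⟨0, by simp, by simp⟩, rfl⟩

theorem nl_le_hd {r n : ℕ} (f : BF n) {g : BF n} (hg : g ∈ RM r n) : nl r f ≤ hd f g :=
  Nat.sInf_le ⟨g, hg, rfl⟩

theorem concat_snoc_zero {n : ℕ} (f₁ f₂ : BF n) (y : Fin n → ZMod 2) :
    concat f₁ f₂ (Fin.snoc y 0 : Fin (n + 1) → ZMod 2) = f₁ y := by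
  have h : (Fin.snoc y 0 : Fin (n + 1) → ZMod 2) ∘ Fin.castSucc = y := by
    funext i
    simp
  simp [concat, h]

theorem concat_snoc_one {n : ℕ} (f₁ f₂ : BF n) (y : Fin n → ZMod 2) :
    concat f₁ f₂ (Fin.snoc y 1 : Fin (n + 1) → ZMod 2) = f₂ y := by
  have h : (Fin.snoc y 1 : Fin (n + 1) → ZMod 2) ∘ Fin.castSucc = y := by
    funext i
    simp
  simp [concat, h, CharTwo.add_self_eq_zero]

theorem hd_concat_le {n : ℕ} (f₁ f₂ h₁ h₂ : BF n) :
    hd (concat f₁ f₂) (concat h₁ h₂) ≤ hd f₁ h₁ + hd f₂ h₂ := by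
  classical
  unfold hd
  let s (c : ZMod 2) (y : Fin n → ZMod 2) : Fin (n + 1) → ZMod 2 := Fin.snoc y c
  refine (Finset.card_le_card (t := (Finset.univ.filter fun x => f₁ x ≠ h₁ x).image (s 0) ∪
    (Finset.univ.filter fun x => f₂ x ≠ h₂ x).image (s 1)) ?_).trans
    ((Finset.card_union_le _ _).trans
      (add_le_add Finset.card_image_le Finset.card_image_le))
  intro x hx
  obtain ⟨y, c, rfl⟩ : ∃ y c, x = s c y := ⟨Fin.init x, x (Fin.last n), (Fin.snoc_init_self x).symm⟩
  have hc : c = 0 ∨ c = 1 :=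
    (by decide : ∀ c : ZMod 2, c = 0 ∨ c = 1) c
  rw [Finset.mem_filter] at hx
  rw [Finset.mem_union, Finset.mem_image, Finset.mem_image]
  rcases hc with rfl | rfl
  · refine Or.inl ⟨y, ?_, rfl⟩
    simpa [s, concat_snoc_zero] using hx.2
  · refine Or.inr ⟨y, ?_, rfl⟩
    simpa [s, concat_snoc_one] using hx.2

theorem concat_add_mem_RM {r n : ℕ} {g l₁ l₂ : BF n} (hg : g ∈ RM (r + 1) n)
    (hl₁ : l₁ ∈ RM r n) (hl₂ : l₂ ∈ RM r n) :
    concat (l₁ + g) (l₂ + g) ∈ RM (r + 1) (n + 1) := by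
  obtain ⟨p, hp, hgp⟩ := hg
  obtain ⟨q₁, hq₁, hlq₁⟩ := hl₁
  obtain ⟨q₂, hq₂, hlq₂⟩ := hl₂
  refine ⟨MvPolynomial.rename Fin.castSucc (p + q₁) +
    MvPolynomial.X (Fin.last n) * MvPolynomial.rename Fin.castSucc (q₁ + q₂), ?_, fun x => ?_⟩
  · have h₁ := MvPolynomial.totalDegree_rename_le (Fin.castSucc : Fin n → Fin (n + 1)) (p + q₁)
    have h₂ := MvPolynomial.totalDegree_rename_le (Fin.castSucc : Fin n → Fin (n + 1)) (q₁ + q₂)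
    have h₃ := MvPolynomial.totalDegree_add p q₁
    have h₄ := MvPolynomial.totalDegree_add q₁ q₂
    have h₅ := MvPolynomial.totalDegree_mul (MvPolynomial.X (R := ZMod 2) (Fin.last n))
      (MvPolynomial.rename Fin.castSucc (q₁ + q₂))
    rw [MvPolynomial.totalDegree_X] at h₅
    refine (MvPolynomial.totalDegree_add _ _).trans (max_le ?_ ?_) <;> grind
  · simp only [concat, Pi.add_apply, hgp, hlq₁, hlq₂, map_add, map_mul, MvPolynomial.eval_X,
      MvPolynomial.eval_rename]
    linear_combination x (Fin.last n) * MvPolynomial.eval (x ∘ Fin.castSucc) p *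
      CharTwo.two_eq_zero (R := ZMod 2)

theorem hd_add_right {n : ℕ} (f g h : BF n) : hd f (h + g) = hd (f + g) h := by
  unfold hd
  congr 1
  ext x
  simp only [Finset.mem_filter, Finset.mem_univ, true_and, Pi.add_apply, ne_eq,
    ← CharTwo.sub_eq_add (f x), sub_eq_iff_eq_add]

/-- For `g ∈ RM(r+1,n)`, the `(r+1)`-st order nonlinearity of `f₁ || f₂` is at most
`nl_r(f₁ + g) + nl_r(f₂ + g)`. -/
theorem nl_succ_concat_le {r n : ℕ} (f₁ f₂ : BF n) {g : BF n} (hg : g ∈ RM (r + 1) n) :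
    nl (r + 1) (concat f₁ f₂) ≤ nl r (f₁ + g) + nl r (f₂ + g) := by
  obtain ⟨l₁, hl₁, h₁⟩ := exists_hd_eq_nl r (f₁ + g)
  obtain ⟨l₂, hl₂, h₂⟩ := exists_hd_eq_nl r (f₂ + g)
  rw [h₁, h₂, ← hd_add_right, ← hd_add_right]
  exact (nl_le_hd _ (concat_add_mem_RM hg hl₁ hl₂)).trans (hd_concat_le _ _ _ _)

/-- For every `g ∈ RM(2,6)`, `nl_2(f1||f2) ≤ nl(f1 + g) + nl(f2 + g)`. -/
theorem stmt19 (f1 f2 : BF 6) :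
    ∀ g ∈ RM 2 6, nl 2 (concat f1 f2) ≤ nl 1 (f1 + g) + nl 1 (f2 + g) := by
  exact fun _ hg => nl_succ_concat_le f1 f2 hg
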